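/- Let d be an even integer with d > 2 and set λ = (d−2)/2. If f : ℝ^d → E (E a normed space) satisfies ‖f‖_{B²} < ∞ and g : ℝ^d → ℝ is measurable with ‖g‖_{B²} < ∞, then for every x ∈ ℝ^d one has ∫_{ℝ^d} (1+|y|)^λ |g(y−x)| ‖f(y)‖ dy ≤ (1+|x|)^{λ/2} ‖g‖_{B²} ‖f‖_{B²} < ∞. (This is the integrability of τ_x g · f in B(ℝ^d) ⊗ ℝ_d which makes the Clifford short-time Fourier transform V_g f(x,ω) = (2π)^{−d/2} ∫ K_−(t,ω) g(t−x) f(t) dt well defined for f ∈ B²(ℝ^d) ⊗ ℝ_d and radial window g ∈ B²(ℝ^d).) -/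

import Mathlib

open MeasureTheory

/-- The polynomial weight `(1 + ‖y‖) ^ s` is submultiplicative for `s ≥ 0`. -/
lemma one_add_norm_rpow_le_mul {V : Type*} [SeminormedAddCommGroup V] {s : ℝ} (hs : 0 ≤ s)
    (x y : V) : (1 + ‖y‖) ^ s ≤ (1 + ‖x‖) ^ s * (1 + ‖y - x‖) ^ s := by
  rw [← Real.mul_rpow (by positivity) (by positivity)]
  refine Real.rpow_le_rpow (by positivity) ?_ hs
  have htri : ‖y‖ ≤ ‖x‖ + ‖y - x‖ := norm_le_insert' y x
  nlinarith [mul_nonneg (norm_nonneg x) (norm_nonneg (y - x))]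

lemma sq_one_add_norm_rpow_half_mul {V : Type*} [SeminormedAddCommGroup V] (s a : ℝ) (y : V) :
    ((1 + ‖y‖) ^ (s / 2) * a) ^ 2 = (1 + ‖y‖) ^ s * a ^ 2 := by
  rw [mul_pow, ← Real.rpow_mul_natCast (by positivity)]
  norm_num

/-- A function whose square is integrable against `(1 + ‖y‖) ^ s` lies in `L²` after
multiplication by `(1 + ‖y‖) ^ (s / 2)`. -/
lemma memLp_two_one_add_norm_rpow_half_mul {V : Type*} [NormedAddCommGroup V]
    [MeasurableSpace V] [OpensMeasurableSpace V] {μ : Measure V} {s : ℝ} {u : V → ℝ}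
    (hu : AEStronglyMeasurable u μ) (hint : Integrable (fun y => (1 + ‖y‖) ^ s * u y ^ 2) μ) :
    MemLp (fun y => (1 + ‖y‖) ^ (s / 2) * u y) 2 μ := by
  have hw : Measurable fun y : V => (1 + ‖y‖) ^ (s / 2) := by fun_prop
  refine (memLp_two_iff_integrable_sq (hw.aestronglyMeasurable.mul hu)).2 ?_
  simpa only [Pi.mul_apply, sq_one_add_norm_rpow_half_mul] using hint

/-- Let `d` be even with `d > 2`, `λ = (d-2)/2`. If `f ∈ B²(ℝ^d) ⊗ ℝ_d`
and `g ∈ B²(ℝ^d)`, then for every `x` the function `τ_x g · f` lies in `B(ℝ^d) ⊗ ℝ_d` and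
`∫ (1+|y|)^λ |g(y-x)| ‖f(y)‖ dy ≤ (1+|x|)^{λ/2} ‖g‖_{B²} ‖f‖_{B²}`. -/
theorem translate_mul_mem_B
    (d : ℕ) (hd : Even d) (hd2 : 2 < d)
    (lam : ℝ) (hlam : lam = ((d : ℝ) - 2) / 2)
    {E : Type*} [NormedAddCommGroup E]
    (f : EuclideanSpace ℝ (Fin d) → E)
    (hfm : AEStronglyMeasurable f (volume : Measure (EuclideanSpace ℝ (Fin d))))
    (hf : Integrable (fun y => (1 + ‖y‖) ^ lam * ‖f y‖ ^ 2)
      (volume : Measure (EuclideanSpace ℝ (Fin d))))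
    (g : EuclideanSpace ℝ (Fin d) → ℝ) (hgm : Measurable g)
    (hg : Integrable (fun y => (1 + ‖y‖) ^ lam * (g y) ^ 2)
      (volume : Measure (EuclideanSpace ℝ (Fin d))))
    (x : EuclideanSpace ℝ (Fin d)) :
    Integrable (fun y => (1 + ‖y‖) ^ lam * |g (y - x)| * ‖f y‖)
        (volume : Measure (EuclideanSpace ℝ (Fin d))) ∧
      (∫ y, (1 + ‖y‖) ^ lam * |g (y - x)| * ‖f y‖)
        ≤ (1 + ‖x‖) ^ (lam / 2)
          * (∫ y, (1 + ‖y‖) ^ lam * (g y) ^ 2) ^ ((1 : ℝ) / 2)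
          * (∫ y, (1 + ‖y‖) ^ lam * ‖f y‖ ^ 2) ^ ((1 : ℝ) / 2) := by
  have hs : 0 ≤ lam / 2 := by
    have hd' : (2 : ℝ) < d := by exact_mod_cast hd2
    rw [hlam]
    linarith
  have hF := memLp_two_one_add_norm_rpow_half_mul hfm.norm hf
  have hG₀ : MemLp (fun y => (1 + ‖y‖) ^ (lam / 2) * |g y|) 2 volume :=
    memLp_two_one_add_norm_rpow_half_mul hgm.abs.aestronglyMeasurable
      (by simpa only [sq_abs] using hg)
  have hG : MemLp (fun y => (1 + ‖y - x‖) ^ (lam / 2) * |g (y - x)|) 2 volume :=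
    hG₀.comp_measurePreserving (measurePreserving_sub_right volume x)
  have hbound : ∀ y, (1 + ‖y‖) ^ lam * |g (y - x)| * ‖f y‖ ≤ (1 + ‖x‖) ^ (lam / 2) *
      (((1 + ‖y - x‖) ^ (lam / 2) * |g (y - x)|) * ((1 + ‖y‖) ^ (lam / 2) * ‖f y‖)) := by
    intro y
    have hsplit : (1 + ‖y‖) ^ lam = (1 + ‖y‖) ^ (lam / 2) * (1 + ‖y‖) ^ (lam / 2) := by
      rw [← Real.rpow_add (by positivity), add_halves]
    calc (1 + ‖y‖) ^ lam * |g (y - x)| * ‖f y‖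
        = (1 + ‖y‖) ^ (lam / 2) * (|g (y - x)| * ((1 + ‖y‖) ^ (lam / 2) * ‖f y‖)) := by
          rw [hsplit]; ring
      _ ≤ ((1 + ‖x‖) ^ (lam / 2) * (1 + ‖y - x‖) ^ (lam / 2)) *
            (|g (y - x)| * ((1 + ‖y‖) ^ (lam / 2) * ‖f y‖)) := by
          gcongr
          exact one_add_norm_rpow_le_mul hs x y
      _ = _ := by ring
  have hmaj := (hG.integrable_mul hF).const_mul ((1 + ‖x‖) ^ (lam / 2))
  have hw : Measurable fun y : EuclideanSpace ℝ (Fin d) => (1 + ‖y‖) ^ lam * |g (y - x)| := by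
    fun_prop
  have hint : Integrable (fun y => (1 + ‖y‖) ^ lam * |g (y - x)| * ‖f y‖) volume := by
    refine hmaj.mono' (hw.aestronglyMeasurable.mul hfm.norm) (.of_forall fun y => ?_)
    rw [Real.norm_of_nonneg (by positivity)]
    exact hbound y
  refine ⟨hint, (integral_mono hint hmaj hbound).trans ?_⟩
  simp only [Pi.mul_apply]
  rw [integral_const_mul, mul_assoc]
  gcongr
  have holder := integral_mul_le_Lp_mul_Lq_of_nonneg (μ := volume)
    (f := fun y => (1 + ‖y - x‖) ^ (lam / 2) * |g (y - x)|)
    (g := fun y => (1 + ‖y‖) ^ (lam / 2) * ‖f y‖) Real.HolderConjugate.two_two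
    (.of_forall fun y => by dsimp; positivity) (.of_forall fun y => by dsimp; positivity)
    (by simpa using hG) (by simpa using hF)
  simp only [Real.rpow_two, sq_one_add_norm_rpow_half_mul, sq_abs] at holder
  rwa [integral_sub_right_eq_self (fun y => (1 + ‖y‖) ^ lam * g y ^ 2) x] at holder
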